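/- arXiv:1505.00144 — 3 statements merged into one kernel-verified Lean document; each statement's English description precedes it below -/
import Mathlib

section
/- Suppose that for every n and every synchronizing set of n×n binary stochastic matrices there is a synchronizing word of length at most (n−1)² (i.e., the Černý conjecture holds). Then every column-primitive finite set M of n×n matrices with nonnegative entries and no zero row has a positive-column word of length at most (n−1)². -/
open Matrix

/-- A square real matrix is binary stochastic if all entries are `0` or `1` and every row sums
to `1` (i.e. each row has exactly one `1`). -/
def IsBinaryStochastic {n : ℕ} (B : Matrix (Fin n) (Fin n) ℝ) : Prop :=
  (∀ i j, B i j = 0 ∨ B i j = 1) ∧ ∀ i, ∑ j, B i j = 1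

/-- The `0`-`1` matrix of a self-map `f`, whose row `i` has its only `1` in column `f i`. -/
def functionMatrix {n : ℕ} (f : Fin n → Fin n) : Matrix (Fin n) (Fin n) ℝ :=
  Matrix.of fun i j => if f i = j then 1 else 0

theorem isBinaryStochastic_functionMatrix {n : ℕ} (f : Fin n → Fin n) :
    IsBinaryStochastic (functionMatrix f) := by
  refine ⟨fun i j => ?_, fun i => by simp [functionMatrix]⟩
  by_cases h : f i = j <;> simp [functionMatrix, h]

theorem functionMatrix_mul_apply {n : ℕ} (f : Fin n → Fin n) (Q : Matrix (Fin n) (Fin n) ℝ)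
    (i j : Fin n) : (functionMatrix f * Q) i j = Q (f i) j := by
  simp [functionMatrix, Matrix.mul_apply]

theorem mul_apply_pos_iff {n : ℕ} {P Q : Matrix (Fin n) (Fin n) ℝ}
    (hP : ∀ i j, 0 ≤ P i j) (hQ : ∀ i j, 0 ≤ Q i j) (i j : Fin n) :
    0 < (P * Q) i j ↔ ∃ l, 0 < P i l ∧ 0 < Q l j := by
  rw [Matrix.mul_apply, Finset.sum_pos_iff_of_nonneg fun l _ => mul_nonneg (hP i l) (hQ l j)]
  constructor
  · rintro ⟨l, -, hl⟩
    exact ⟨l, pos_of_mul_pos_left hl (hQ l j), pos_of_mul_pos_right hl (hP i l)⟩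
  · rintro ⟨l, hl, hl'⟩
    exact ⟨l, Finset.mem_univ l, mul_pos hl hl'⟩

theorem list_prod_nonneg {n : ℕ} {ι : Type*} {A : ι → Matrix (Fin n) (Fin n) ℝ}
    (hA : ∀ k i j, 0 ≤ A k i j) (w : List ι) (i j : Fin n) : 0 ≤ (w.map A).prod i j := by
  induction w generalizing i j with
  | nil => by_cases h : i = j <;> simp [h]
  | cons k w ih =>
    rw [List.map_cons, List.prod_cons, Matrix.mul_apply]
    exact Finset.sum_nonneg fun l _ => mul_nonneg (hA k i l) (ih l j)

/-- The pairs of an index `k` and a self-map that selects a positive entry in each row of `A k`. -/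
abbrev PositiveSelection {n : ℕ} {ι : Type*} (A : ι → Matrix (Fin n) (Fin n) ℝ) : Type _ :=
  {p : ι × (Fin n → Fin n) // ∀ i, 0 < A p.1 i (p.2 i)}

theorem list_prod_pos_of_selection {n : ℕ} {ι : Type*} {A : ι → Matrix (Fin n) (Fin n) ℝ}
    (hA : ∀ k i j, 0 ≤ A k i j) (u : List (PositiveSelection A)) (i j : Fin n)
    (h : 0 < (u.map fun p => functionMatrix p.1.2).prod i j) :
    0 < ((u.map fun p => p.1.1).map A).prod i j := by
  induction u generalizing i with
  | nil => simpa using h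
  | cons p u ih =>
    rw [List.map_cons, List.prod_cons, functionMatrix_mul_apply] at h
    rw [List.map_cons, List.map_cons, List.prod_cons,
      mul_apply_pos_iff (hA p.1.1) (list_prod_nonneg hA _)]
    exact ⟨p.1.2 i, p.2 i, ih _ h⟩

theorem exists_selection_list_prod_pos {n : ℕ} {ι : Type*} {A : ι → Matrix (Fin n) (Fin n) ℝ}
    (hA : ∀ k i j, 0 ≤ A k i j) (hrow : ∀ k i, ∃ j, 0 < A k i j) (w : List ι) (j : Fin n) :
    ∃ u : List (PositiveSelection A), ∀ i, 0 < (w.map A).prod i j →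
      0 < (u.map fun p => functionMatrix p.1.2).prod i j := by
  induction w with
  | nil => exact ⟨[], fun i h => by simpa using h⟩
  | cons k w ih =>
    obtain ⟨u, hu⟩ := ih
    have hsel : ∀ i, ∃ l, 0 < A k i l ∧
        (0 < ((k :: w).map A).prod i j → 0 < (w.map A).prod l j) := by
      intro i
      by_cases h : 0 < ((k :: w).map A).prod i j
      · have h' := h
        rw [List.map_cons, List.prod_cons,
          mul_apply_pos_iff (hA k) (list_prod_nonneg hA w)] at h'
        obtain ⟨l, hl, hl'⟩ := h'
        exact ⟨l, hl, fun _ => hl'⟩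
      · obtain ⟨l, hl⟩ := hrow k i
        exact ⟨l, hl, fun h' => absurd h' h⟩
    choose f hf hf' using hsel
    refine ⟨⟨(k, f), hf⟩ :: u, fun i hi => ?_⟩
    rw [List.map_cons, List.prod_cons, functionMatrix_mul_apply]
    exact hu _ (hf' i hi)

/-- If the Černý conjecture holds — every synchronizing finite set of `n × n`
binary stochastic matrices has a synchronizing word of length at most `(n-1)²` — then every
column-primitive finite set of nonnegative `n × n` matrices with no zero row has a
positive-column word of length at most `(n-1)²`. -/
theorem stmt7
    (cerny : ∀ (n' m' : ℕ) (B : Fin m' → Matrix (Fin n') (Fin n') ℝ),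
      (∀ k, IsBinaryStochastic (B k)) →
      (∃ w : List (Fin m'), ∃ j, ∀ i, 0 < (w.map B).prod i j) →
      ∃ w : List (Fin m'), w.length ≤ (n' - 1) ^ 2 ∧
        ∃ j, ∀ i, 0 < (w.map B).prod i j) :
    ∀ (n m : ℕ) (A : Fin m → Matrix (Fin n) (Fin n) ℝ),
      (∀ k i j, 0 ≤ A k i j) →
      (∀ k i, ∃ j, 0 < A k i j) →
      (∃ w : List (Fin m), ∃ j, ∀ i, 0 < (w.map A).prod i j) →
      ∃ w : List (Fin m), w.length ≤ (n - 1) ^ 2 ∧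
        ∃ j, ∀ i, 0 < (w.map A).prod i j := by
  intro n m A hA hrow ⟨w, j, hw⟩
  classical
  let e := Fintype.equivFin (PositiveSelection A)
  obtain ⟨u, hu⟩ := exists_selection_list_prod_pos hA hrow w j
  obtain ⟨v, hv, j', hj'⟩ := cerny n _ (fun k => functionMatrix (e.symm k).1.2)
    (fun k => isBinaryStochastic_functionMatrix _)
    ⟨u.map e, j, fun i => by simpa [Function.comp_def] using hu i (hw i)⟩
  refine ⟨(v.map e.symm).map fun p => p.1.1, by simpa using hv, j', fun i => ?_⟩
  refine list_prod_pos_of_selection hA _ i j' ?_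
  simpa [Function.comp_def] using hj' i
end

section
/- Let M be a finite set of n×n binary stochastic matrices (a semi-automaton on n states). If M is synchronizing, i.e., some finite product of matrices from M has a strictly positive column, then M has a synchronizing word of length at most (n³ − n)/6. -/
open Matrix

section SkewBollobas

variable {K : Type*} [Field K]

/-- A product of `s` linear forms lies in the span of the monomials of degree `s`. -/
theorem prod_linearForm_mem_span {α : Type*} {d : ℕ} (c : α → Fin d → K) (s : ℕ) (B : Finset α)
    (hB : B.card = s) :
    (fun x : Fin d → K => ∏ b ∈ B, ∑ k, c b k * x k) ∈
      Submodule.span K (Set.range fun (t : Sym (Fin d) s) (x : Fin d → K) =>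
        ((t : Multiset (Fin d)).map x).prod) := by
  classical
  induction s generalizing B with
  | zero =>
    rw [Finset.card_eq_zero] at hB
    subst hB
    refine Submodule.subset_span ⟨Sym.nil, ?_⟩
    funext x
    simp
  | succ s ih =>
    obtain ⟨b, B', hb, rfl, hB'⟩ := Finset.card_eq_succ.mp hB
    have key : ∀ g ∈ Submodule.span K (Set.range fun (t : Sym (Fin d) s) (x : Fin d → K) =>
        ((t : Multiset (Fin d)).map x).prod),
        (fun x => (∑ k, c b k * x k) * g x) ∈
          Submodule.span K (Set.range fun (t : Sym (Fin d) (s + 1)) (x : Fin d → K) =>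
            ((t : Multiset (Fin d)).map x).prod) := by
      intro g hg
      induction hg using Submodule.span_induction with
      | mem g hg =>
        obtain ⟨t, rfl⟩ := hg
        have h : (fun x : Fin d → K =>
            (∑ k, c b k * x k) * ((t : Multiset (Fin d)).map x).prod) =
            ∑ k, c b k • fun x : Fin d → K =>
              (((k ::ₛ t : Sym (Fin d) (s + 1)) : Multiset (Fin d)).map x).prod := by
          funext x
          simp [Finset.sum_mul, mul_assoc, Finset.sum_apply, Sym.coe_cons]
        rw [h]
        exact Submodule.sum_mem _ fun k _ =>
          Submodule.smul_mem _ _ (Submodule.subset_span ⟨k ::ₛ t, rfl⟩)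
      | zero =>
        convert Submodule.zero_mem _ using 1
        funext x
        simp
      | add g h _ _ ihg ihh =>
        convert Submodule.add_mem _ ihg ihh using 1
        funext x
        simp [mul_add]
      | smul a g _ ihg =>
        convert Submodule.smul_mem _ a ihg using 1
        funext x
        simp [mul_left_comm]
    convert key _ (ih B' hB') using 1
    funext x
    rw [Finset.prod_insert hb]

/-- Functions whose evaluations at suitable points form a triangular matrix with nonzero diagonal
are linearly independent. -/
theorem linearIndependent_of_triangular_eval {X : Type*} {N : ℕ} (f : Fin N → X → K)
    (x : Fin N → X) (hdiag : ∀ i, f i (x i) ≠ 0) (htri : ∀ i j, i < j → f i (x j) = 0) :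
    LinearIndependent K f := by
  refine LinearIndependent.of_comp (LinearMap.funLeft K K x) ?_
  let M : Matrix (Fin N) (Fin N) K := Matrix.of fun i j => f i (x j)
  have hM : IsUnit M := by
    rw [Matrix.isUnit_iff_isUnit_det, Matrix.det_of_isLowerTriangular M fun i j h => htri i j h]
    exact (Finset.prod_ne_zero_iff.mpr fun i _ => hdiag i).isUnit
  exact Matrix.linearIndependent_rows_iff_isUnit.mpr hM

/-- Frankl's skew version of Bollobás' theorem on set pairs, for points of a field. -/
theorem card_le_choose_of_skew_pairs_field {α : Type*} (e : α → K) (he : Function.Injective e)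
    {N r s : ℕ} (P Q : Fin N → Finset α)
    (hP : ∀ i, (P i).card = r) (hQ : ∀ i, (Q i).card = s)
    (hdisj : ∀ i, Disjoint (P i) (Q i)) (hmeet : ∀ i j, i < j → ¬ Disjoint (P j) (Q i)) :
    N ≤ (r + s).choose s := by
  let p : Fin N → Polynomial K := fun i => ∏ a ∈ P i, (Polynomial.X - Polynomial.C (e a))
  let f : Fin N → (Fin (r + 1) → K) → K := fun i x => ∏ b ∈ Q i, ∑ k : Fin (r + 1), e b ^ (k : ℕ) * x k
  let x : Fin N → Fin (r + 1) → K := fun i k => (p i).coeff k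
  have hf : ∀ i j, f i (x j) = ∏ b ∈ Q i, ∏ a ∈ P j, (e b - e a) := by
    intro i j
    refine Finset.prod_congr rfl fun b _ => ?_
    have hdeg : (p j).natDegree < r + 1 := by
      rw [Polynomial.natDegree_prod_of_monic _ _ fun a _ => Polynomial.monic_X_sub_C (e a)]
      simp [hP]
    have := Polynomial.eval_eq_sum_range' hdeg (e b)
    rw [← Fin.sum_univ_eq_sum_range fun k => (p j).coeff k * e b ^ k] at this
    simp only [p, Polynomial.eval_prod, Polynomial.eval_sub, Polynomial.eval_X,
      Polynomial.eval_C] at this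
    rw [this]
    exact Finset.sum_congr rfl fun k _ => mul_comm _ _
  have hli : LinearIndependent K f := by
    refine linearIndependent_of_triangular_eval f x (fun i => ?_) fun i j hij => ?_
    · rw [hf]
      refine Finset.prod_ne_zero_iff.mpr fun b hb => Finset.prod_ne_zero_iff.mpr fun a ha => ?_
      rw [sub_ne_zero]
      intro hab
      exact Finset.disjoint_left.mp (hdisj i) ha (he hab ▸ hb)
    · obtain ⟨a, haP, haQ⟩ := Finset.not_disjoint_iff.mp (hmeet i j hij)
      rw [hf]
      exact Finset.prod_eq_zero haQ (Finset.prod_eq_zero haP (sub_self _))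
  let mono : Sym (Fin (r + 1)) s → (Fin (r + 1) → K) → K :=
    fun t x => ((t : Multiset (Fin (r + 1))).map x).prod
  classical
  have hspan : Set.range f ≤ Submodule.span K (Set.range mono) := by
    rintro _ ⟨i, rfl⟩
    exact prod_linearForm_mem_span (fun b (k : Fin (r + 1)) => e b ^ (k : ℕ)) s (Q i) (hQ i)
  have hcard := linearIndependent_le_span' f hli (Set.range mono) hspan
  rw [Cardinal.mk_fin] at hcard
  have hle : N ≤ Fintype.card (Set.range mono) := by exact_mod_cast hcard
  calc N ≤ Fintype.card (Set.range mono) := hle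
    _ ≤ Fintype.card (Sym (Fin (r + 1)) s) := Fintype.card_range_le mono
    _ = (r + s).choose s := by
      rw [Sym.card_sym_eq_choose, Fintype.card_fin, Nat.add_right_comm, Nat.add_sub_cancel]

end SkewBollobas

/-- Frankl's skew version of Bollobás' theorem on set pairs. -/
theorem card_le_choose_of_skew_pairs {α : Type*} {N r s : ℕ} (P Q : Fin N → Finset α)
    (hP : ∀ i, (P i).card = r) (hQ : ∀ i, (Q i).card = s)
    (hdisj : ∀ i, Disjoint (P i) (Q i)) (hmeet : ∀ i j, i < j → ¬ Disjoint (P j) (Q i)) :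
    N ≤ (r + s).choose s :=
  card_le_choose_of_skew_pairs_field
    (fun a : α => algebraMap (MvPolynomial α ℚ) (FractionRing (MvPolynomial α ℚ))
      (MvPolynomial.X a))
    ((IsFractionRing.injective _ _).comp (MvPolynomial.X_injective)) P Q hP hQ hdisj hmeet

section Automaton

variable {α σ : Type*}

/-- The state reached from `q` by reading the word `w`. -/
def runWord (δ : α → σ → σ) (w : List α) (q : σ) : σ :=
  w.foldl (fun q a => δ a q) q

theorem runWord_append (δ : α → σ → σ) (u v : List α) (q : σ) :
    runWord δ (u ++ v) q = runWord δ v (runWord δ u q) :=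
  List.foldl_append

/-- If some word identifies two states of `S`, then a word of length at most
`(|σ| - |S| + 2).choose 2` does. -/
theorem exists_short_merging_word [Fintype σ] (δ : α → σ → σ) (S : Finset σ)
    (h : ∃ w, ¬ Set.InjOn (runWord δ w) S) :
    ∃ w, w.length ≤ (Fintype.card σ - S.card + 2).choose 2 ∧ ¬ Set.InjOn (runWord δ w) S := by
  classical
  have hex : ∃ l, ∃ w : List α, w.length = l ∧ ¬ Set.InjOn (runWord δ w) S :=
    let ⟨w, hw⟩ := h
    ⟨_, w, rfl, hw⟩
  obtain ⟨w, hlen, hw⟩ := Nat.find_spec hex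
  have hmin : ∀ u : List α, u.length < w.length → Set.InjOn (runWord δ u) S := by
    intro u hu
    by_contra hinj
    exact Nat.find_min hex (hlen ▸ hu) ⟨u, rfl, hinj⟩
  refine ⟨w, ?_, hw⟩
  simp only [Set.InjOn, not_forall] at hw
  obtain ⟨p, hp, q, hq, hpq, hne⟩ := hw
  have hinj : ∀ i : Fin w.length, Set.InjOn (runWord δ (w.take i)) S := fun i =>
    hmin _ (by simp)
  let P : Fin w.length → Finset σ := fun i =>
    {runWord δ (w.take i) p, runWord δ (w.take i) q}
  let Q : Fin w.length → Finset σ := fun i => (S.image (runWord δ (w.take i)))ᶜ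
  have hPne : ∀ i : Fin w.length, runWord δ (w.take i) p ≠ runWord δ (w.take i) q :=
    fun i heq => hne (hinj i hp hq heq)
  have hbound := card_le_choose_of_skew_pairs (r := 2) (s := Fintype.card σ - S.card) P Q
    (fun i => Finset.card_pair (hPne i))
    (fun i => by rw [Finset.card_compl, Finset.card_image_of_injOn (hinj i)])
    (fun i => by
      rw [← Finset.subset_compl_iff_disjoint_right, compl_compl, Finset.insert_subset_iff,
        Finset.singleton_subset_iff]
      exact ⟨Finset.mem_image_of_mem _ hp, Finset.mem_image_of_mem _ hq⟩)
    (fun i j hij => by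
      rw [← Finset.subset_compl_iff_disjoint_right, compl_compl, Finset.insert_subset_iff,
        Finset.singleton_subset_iff, Finset.mem_image, Finset.mem_image]
      rintro ⟨⟨p', hp', hpp⟩, q', hq', hqq⟩
      have hlt : (w.take i ++ w.drop j).length < w.length := by
        simp only [List.length_append, List.length_take, List.length_drop]
        have : (i : ℕ) < j := hij
        omega
      have heq : runWord δ (w.take i ++ w.drop j) p' = runWord δ (w.take i ++ w.drop j) q' := by
        rw [runWord_append, runWord_append, hpp, hqq, ← runWord_append, ← runWord_append,
          List.take_append_drop, hpq]
      have := hmin _ hlt hp' hq' heq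
      exact hPne j (by rw [← hpp, ← hqq, this]))
  rwa [← Nat.choose_symm_add, add_comm] at hbound

/-- Greedy compression: any set of at most `k + 1` states is collapsed by a short word. -/
theorem exists_short_collapsing_word [Fintype σ] [DecidableEq σ] (δ : α → σ → σ) (w₀ : List α)
    (hw₀ : ∀ p q, runWord δ w₀ p = runWord δ w₀ q) (k : ℕ) (S : Finset σ)
    (hS : S.card ≤ k + 1) :
    ∃ w : List α, w.length + (Fintype.card σ - k + 1).choose 3 ≤ (Fintype.card σ + 1).choose 3 ∧
      (S.image (runWord δ w)).card ≤ 1 := by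
  induction k generalizing S with
  | zero => exact ⟨[], by simp, Finset.card_image_le.trans hS⟩
  | succ k ih =>
    rcases Nat.lt_or_ge S.card (k + 2) with hlt | hge
    · obtain ⟨w, hw, hc⟩ := ih S (by omega)
      refine ⟨w, le_trans (Nat.add_le_add_left (Nat.choose_le_choose 3 (by omega)) _) hw, hc⟩
    · have hcard : S.card = k + 2 := le_antisymm hS hge
      have hle : S.card ≤ Fintype.card σ := Finset.card_le_univ S
      have hmerge : ∃ w, ¬ Set.InjOn (runWord δ w) S := by
        obtain ⟨p, hp, q, hq, hne⟩ := Finset.one_lt_card.mp (by omega : 1 < S.card)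
        exact ⟨w₀, fun hinj => hne (hinj hp hq (hw₀ p q))⟩
      obtain ⟨u, hu, hninj⟩ := exists_short_merging_word δ S hmerge
      have hlt : (S.image (runWord δ u)).card < S.card :=
        lt_of_le_of_ne Finset.card_image_le fun h => hninj (Finset.card_image_iff.mp h)
      obtain ⟨v, hv, hc⟩ := ih (S.image (runWord δ u)) (by omega)
      refine ⟨u ++ v, ?_, ?_⟩
      · have hpascal := Nat.choose_succ_succ (Fintype.card σ - k) 2
        rw [hcard, show Fintype.card σ - (k + 2) + 2 = Fintype.card σ - k by omega] at hu
        rw [show Fintype.card σ - (k + 1) + 1 = Fintype.card σ - k by omega, List.length_append]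
        simp only [Nat.succ_eq_add_one, Nat.reduceAdd] at hpascal
        omega
      · rw [Finset.image_image] at hc
        convert hc using 3
        funext q
        exact runWord_append δ u v q

end Automaton

theorem succ_choose_three_eq (n : ℕ) : (n + 1).choose 3 = (n ^ 3 - n) / 6 := by
  have h : (n + 1).choose 3 * 6 + n = n ^ 3 := by
    induction n with
    | zero => rfl
    | succ n ih =>
      have h2 : (n + 1).choose 2 * 2 = (n + 1) * n := by
        rw [Nat.choose_two_right, Nat.add_sub_cancel]
        exact Nat.div_mul_cancel (by
          rw [mul_comm]; exact (Nat.even_mul_succ_self n).two_dvd)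
      have hpascal := Nat.choose_succ_succ (n + 1) 2
      simp only [Nat.succ_eq_add_one, Nat.reduceAdd] at hpascal
      rw [hpascal]
      nlinarith
  omega

theorem IsBinaryStochastic.exists_eq_ite {n : ℕ} {B : Matrix (Fin n) (Fin n) ℝ}
    (hB : IsBinaryStochastic B) :
    ∃ f : Fin n → Fin n, ∀ i j, B i j = if f i = j then 1 else 0 := by
  have hrow : ∀ i, ∃ k, ∀ j, B i j = if k = j then 1 else 0 := by
    intro i
    obtain ⟨k, hk⟩ : ∃ k, B i k = 1 := by
      by_contra! hne
      have := hB.2 i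
      rw [Finset.sum_eq_zero fun j _ => (hB.1 i j).resolve_right (hne j)] at this
      exact zero_ne_one this
    refine ⟨k, fun j => ?_⟩
    split_ifs with hkj
    · exact hkj ▸ hk
    · refine (hB.1 i j).resolve_right fun hj => ?_
      have hle : ∑ l ∈ {k, j}, B i l ≤ ∑ l, B i l :=
        Finset.sum_le_sum_of_subset_of_nonneg (Finset.subset_univ _) fun l _ _ => by
          rcases hB.1 i l with h | h <;> simp [h]
      rw [Finset.sum_pair hkj, hk, hj, hB.2 i] at hle
      norm_num at hle
  choose f hf using hrow
  exact ⟨f, hf⟩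

theorem prod_map_apply_eq_ite {n m : ℕ} {A : Fin m → Matrix (Fin n) (Fin n) ℝ}
    {δ : Fin m → Fin n → Fin n} (hδ : ∀ k i j, A k i j = if δ k i = j then 1 else 0)
    (w : List (Fin m)) (i j : Fin n) :
    (w.map A).prod i j = if runWord δ w i = j then 1 else 0 := by
  induction w generalizing i with
  | nil =>
    simp only [List.map_nil, List.prod_nil, Matrix.one_apply]
    rfl
  | cons k w ih =>
    simp only [List.map_cons, List.prod_cons, Matrix.mul_apply, hδ, ih, ite_mul, one_mul, zero_mul,
      Finset.sum_ite_eq, Finset.mem_univ, if_true]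
    rfl

/-- **Pin–Frankl bound.** If a finite set of `n × n` binary stochastic matrices
(a semi-automaton on `n` states) is synchronizing, then it has a synchronizing word of length
at most `(n³ - n) / 6`. -/
theorem stmt9 (n m : ℕ)
    (A : Fin m → Matrix (Fin n) (Fin n) ℝ)
    (hbin : ∀ k, IsBinaryStochastic (A k))
    (hsync : ∃ w : List (Fin m), ∃ j, ∀ i, 0 < (w.map A).prod i j) :
    ∃ w : List (Fin m), w.length ≤ (n ^ 3 - n) / 6 ∧
      ∃ j, ∀ i, 0 < (w.map A).prod i j := by
  choose δ hδ using fun k => (hbin k).exists_eq_ite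
  have hpos : ∀ w i j, 0 < (w.map A).prod i j ↔ runWord δ w i = j := by
    intro w i j
    rw [prod_map_apply_eq_ite hδ]
    split_ifs with h <;> simp [h]
  simp only [hpos] at hsync ⊢
  obtain ⟨w₀, j₀, hw₀⟩ := hsync
  have hn : 0 < n := j₀.pos
  obtain ⟨w, hw, hc⟩ := exists_short_collapsing_word δ w₀ (fun p q => (hw₀ p).trans (hw₀ q).symm)
    (n - 1) Finset.univ (by rw [Finset.card_fin]; omega)
  rw [Fintype.card_fin] at hw
  refine ⟨w, ?_, runWord δ w j₀, fun i => ?_⟩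
  · rw [← succ_choose_three_eq]
    omega
  · exact Finset.card_le_one.mp hc _ (Finset.mem_image_of_mem _ (Finset.mem_univ i)) _
      (Finset.mem_image_of_mem _ (Finset.mem_univ j₀))
end

section
/- Let M = {A_1, ..., A_m} be a finite set of n×n matrices with nonnegative entries and strictly positive diagonal entries. Then M is column-primitive if and only if there exists a state j ∈ {1,...,n} such that in the union digraph G(M) (with an edge from i to j whenever (A_k)_{ij} > 0 for some k) every state i has a directed path to j. -/
open Matrix

section PositiveEntries

variable {ι κ : Type*} [Fintype ι]

theorem mul_apply_pos_of_pos {X Y : Matrix ι ι ℝ} (hX : ∀ i j, 0 ≤ X i j)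
    (hY : ∀ i j, 0 ≤ Y i j) {i a j : ι} (hia : 0 < X i a) (haj : 0 < Y a j) :
    0 < (X * Y) i j := by
  rw [Matrix.mul_apply]
  exact Finset.sum_pos' (fun b _ => mul_nonneg (hX i b) (hY b j))
    ⟨a, Finset.mem_univ a, mul_pos hia haj⟩

theorem exists_pos_of_mul_apply_pos {X Y : Matrix ι ι ℝ} (hX : ∀ i j, 0 ≤ X i j)
    {i j : ι} (h : 0 < (X * Y) i j) : ∃ a, 0 < X i a ∧ 0 < Y a j := by
  rw [Matrix.mul_apply] at h
  obtain ⟨a, -, ha⟩ := Finset.exists_lt_of_sum_lt (by simpa using h :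
    ∑ _a : ι, (0 : ℝ) < ∑ a, X i a * Y a j)
  have hXa : 0 < X i a := (hX i a).lt_of_ne' (left_ne_zero_of_mul ha.ne')
  exact ⟨a, hXa, (mul_pos_iff_of_pos_left hXa).mp ha⟩

variable [DecidableEq ι] {A : κ → Matrix ι ι ℝ}

theorem list_prod_apply_nonneg (hnonneg : ∀ k i j, 0 ≤ A k i j) (w : List κ) (i j : ι) :
    0 ≤ (w.map A).prod i j := by
  induction w generalizing i with
  | nil => simp only [List.map_nil, List.prod_nil, Matrix.one_apply]; split_ifs <;> norm_num
  | cons k w ih =>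
    rw [List.map_cons, List.prod_cons, Matrix.mul_apply]
    exact Finset.sum_nonneg fun a _ => mul_nonneg (hnonneg k i a) (ih a)

theorem list_prod_apply_self_pos (hnonneg : ∀ k i j, 0 ≤ A k i j)
    (hdiag : ∀ k i, 0 < A k i i) (w : List κ) (i : ι) : 0 < (w.map A).prod i i := by
  induction w with
  | nil => simp
  | cons k w ih =>
    rw [List.map_cons, List.prod_cons]
    exact mul_apply_pos_of_pos (hnonneg k) (list_prod_apply_nonneg hnonneg w) (hdiag k i) ih

theorem reflTransGen_of_list_prod_apply_pos (hnonneg : ∀ k i j, 0 ≤ A k i j) {w : List κ}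
    {i j : ι} (h : 0 < (w.map A).prod i j) :
    Relation.ReflTransGen (fun a b => ∃ k, 0 < A k a b) i j := by
  induction w generalizing i with
  | nil =>
    have hij : i = j := by
      by_contra hne
      simp [Matrix.one_apply_ne hne] at h
    exact hij ▸ .refl
  | cons k w ih =>
    rw [List.map_cons, List.prod_cons] at h
    obtain ⟨a, hia, haj⟩ := exists_pos_of_mul_apply_pos (hnonneg k) h
    exact .head ⟨k, hia⟩ (ih haj)

theorem exists_list_prod_apply_pos (hnonneg : ∀ k i j, 0 ≤ A k i j) {i j : ι}
    (h : Relation.ReflTransGen (fun a b => ∃ k, 0 < A k a b) i j) :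
    ∃ w : List κ, 0 < (w.map A).prod i j := by
  induction h using Relation.ReflTransGen.head_induction_on with
  | refl => exact ⟨[], by simp⟩
  | head hk _ ih =>
    obtain ⟨k, hk⟩ := hk
    obtain ⟨w, hw⟩ := ih
    refine ⟨k :: w, ?_⟩
    rw [List.map_cons, List.prod_cons]
    exact mul_apply_pos_of_pos (hnonneg k) (list_prod_apply_nonneg hnonneg w) hk hw

theorem exists_list_prod_apply_pos_of_mem (hnonneg : ∀ k i j, 0 ≤ A k i j)
    (hdiag : ∀ k i, 0 < A k i i) {j : ι}
    (h : ∀ i, Relation.ReflTransGen (fun a b => ∃ k, 0 < A k a b) i j) (s : Finset ι) :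
    ∃ w : List κ, ∀ i ∈ s, 0 < (w.map A).prod i j := by
  induction s using Finset.induction_on with
  | empty => exact ⟨[], by simp⟩
  | insert i s _ ih =>
    obtain ⟨u, hu⟩ := ih
    obtain ⟨v, hv⟩ := exists_list_prod_apply_pos hnonneg (h i)
    refine ⟨u ++ v, fun b hb => ?_⟩
    rw [List.map_append, List.prod_append]
    have hmul {a : ι} := mul_apply_pos_of_pos (i := b) (a := a) (j := j)
      (list_prod_apply_nonneg hnonneg u) (list_prod_apply_nonneg hnonneg v)
    obtain rfl | hb := Finset.mem_insert.mp hb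
    · exact hmul (list_prod_apply_self_pos hnonneg hdiag u b) hv
    · exact hmul (hu b hb) (list_prod_apply_self_pos hnonneg hdiag v j)

end PositiveEntries

/-- A finite set of nonnegative `n × n` matrices with strictly positive
diagonals is column-primitive if and only if there is a state `j` reachable from every state
`i` in the union digraph (edge `i → j'` whenever `(A k) i j' > 0` for some `k`). -/
theorem stmt11 (n m : ℕ)
    (A : Fin m → Matrix (Fin n) (Fin n) ℝ)
    (hnonneg : ∀ k i j, 0 ≤ A k i j)
    (hdiag : ∀ k i, 0 < A k i i) :
    (∃ w : List (Fin m), ∃ j, ∀ i, 0 < (w.map A).prod i j)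
    ↔ (∃ j : Fin n, ∀ i : Fin n,
        Relation.ReflTransGen (fun a b : Fin n => ∃ k, 0 < A k a b) i j) := by
  constructor
  · rintro ⟨w, j, hw⟩
    exact ⟨j, fun i => reflTransGen_of_list_prod_apply_pos hnonneg (hw i)⟩
  · rintro ⟨j, hj⟩
    obtain ⟨w, hw⟩ := exists_list_prod_apply_pos_of_mem hnonneg hdiag hj Finset.univ
    exact ⟨w, j, fun i => hw i (Finset.mem_univ i)⟩
end
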